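/- Let 𝒜 be a symmetric W-tensor of even order m and dimension n, with W-tensor decomposition data Γ_1,…,Γ_s and subtensors 𝒜_{Γ_1},…,𝒜_{Γ_s}. Then λ_max(𝒜) = min{ t ∈ ℝ : there exist real numbers ρ_i^l (i ∈ Γ_l, l = 1,…,s) such that for each l = 1,…,s the polynomial −𝒜_{Γ_l} x_{Γ_l}^m + Σ_{i∈Γ_l} ρ_i^l x_i^m is a sums-of-squares polynomial, and Σ_{l ∈ Λ(i)} ρ_i^l ≤ t for each i = 1,…,n }, where Λ(i) = {l ∈ {1,…,s} : i ∈ Γ_l}; moreover this minimum is attained. -/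

import Mathlib

open MvPolynomial Finset

noncomputable section

/-- `tmul A x = 𝒜 x^m`, the homogeneous form associated with an
`m`-th order `n`-dimensional tensor `A`. -/
def tmul {m n : ℕ} (A : (Fin m → Fin n) → ℝ) (x : Fin n → ℝ) : ℝ :=
  ∑ g : Fin m → Fin n, A g * ∏ j, x (g j)

/-- A tensor is symmetric if its entries are invariant under permutations of the indices. -/
def IsSymT {m n : ℕ} (A : (Fin m → Fin n) → ℝ) : Prop :=
  ∀ (σ : Equiv.Perm (Fin m)) (g : Fin m → Fin n), A (g ∘ σ) = A g

/-- `lam` is an H-eigenvalue of a tensor of order `m + 1`: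
there is a nonzero `x` with `𝒜 x^m = lam * x^{[m]}`. -/
def IsHEig {m n : ℕ} (A : (Fin (m + 1) → Fin n) → ℝ) (lam : ℝ) : Prop :=
  ∃ x : Fin n → ℝ, x ≠ 0 ∧ ∀ i : Fin n,
    (∑ g : Fin m → Fin n, A (Fin.cons i g) * ∏ j, x (g j)) = lam * x i ^ m

/-- `𝒜_Γ x_Γ^m` for a subtensor `B` indexed by an index set `Γ ⊆ {1,…,n}`. -/
def subTmul {m n : ℕ} (Γ : Finset (Fin n)) (B : (Fin m → Γ) → ℝ) (x : Fin n → ℝ) : ℝ :=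
  ∑ g : Fin m → Γ, B g * ∏ j, x (g j).1

/-- An index tuple is off-diagonal if not all of its entries coincide. -/
def NotDiag {m : ℕ} {I : Type*} (g : Fin m → I) : Prop := ¬ ∀ j j' : Fin m, g j = g j'

/-- Condition (iii) in the definition of a W-tensor, for one subtensor. -/
def WCondIII {m n : ℕ} {Γ : Finset (Fin n)} (B : (Fin m → Γ) → ℝ) : Prop :=
  (∃ gb : Fin m → Γ, NotDiag gb ∧ ∀ g : Fin m → Γ, NotDiag g →
      (∀ σ : Equiv.Perm (Fin m), g ≠ gb ∘ σ) → B g = 0) ∨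
  (∀ g : Fin m → Γ, NotDiag g → 0 ≤ B g)

/-- Condition (i) in the definition of a W-tensor. -/
def WCondI {n s : ℕ} (Γ : Fin s → Finset (Fin n)) : Prop :=
  ∀ p : Fin s, 0 < (p : ℕ) →
    (((Finset.univ.filter fun l => l < p).biUnion Γ) ∩ Γ p).card ≤ 1

/-- W-tensor. -/
def IsWTensor {m n : ℕ} (A : (Fin m → Fin n) → ℝ) : Prop :=
  ∃ (s : ℕ) (Γ : Fin s → Finset (Fin n)) (B : ∀ l : Fin s, (Fin m → Γ l) → ℝ),
    0 < s ∧ s ≤ n ∧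
    Function.Injective Γ ∧
    Finset.univ.biUnion Γ = Finset.univ ∧
    WCondI Γ ∧
    (∀ x : Fin n → ℝ, tmul A x = ∑ l, subTmul (Γ l) (B l) x) ∧
    (∀ l, WCondIII (B l))

/-- Sums of squares of polynomials. -/
def IsSOSPoly {σ : Type*} (p : MvPolynomial σ ℝ) : Prop :=
  ∃ (r : ℕ) (q : Fin r → MvPolynomial σ ℝ), p = ∑ j, q j ^ 2

/-- The polynomial `𝒜 x^m` as a formal multivariate polynomial. -/
def tpoly {m n : ℕ} (A : (Fin m → Fin n) → ℝ) : MvPolynomial (Fin n) ℝ :=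
  ∑ g : Fin m → Fin n, MvPolynomial.C (A g) * ∏ j, MvPolynomial.X (g j)

/-- The polynomial `𝒜_Γ x_Γ^m` of a subtensor, in the variables `x_Γ`. -/
def subTpoly {m n : ℕ} (Γ : Finset (Fin n)) (B : (Fin m → Γ) → ℝ) : MvPolynomial Γ ℝ :=
  ∑ g : Fin m → Γ, MvPolynomial.C (B g) * ∏ j, MvPolynomial.X (g j)

/-- A (symmetric) tensor is copositive if `𝒜 x^m ≥ 0` for all entrywise-nonnegative `x`. -/
def Copositive {m n : ℕ} (A : (Fin m → Fin n) → ℝ) : Prop :=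
  ∀ x : Fin n → ℝ, (∀ i, 0 ≤ x i) → 0 ≤ tmul A x

theorem IsSumSq.of_eq {R : Type*} [CommRing R] {p q : R} (hp : IsSumSq p) (h : p = q) :
    IsSumSq q := h ▸ hp

theorem isSOSPoly_of_isSumSq {σ : Type*} {p : MvPolynomial σ ℝ} (hp : IsSumSq p) :
    IsSOSPoly p := by
  induction hp with
  | zero => exact ⟨0, Fin.elim0, by simp⟩
  | sq_add a _ ih =>
    obtain ⟨r, q, rfl⟩ := ih
    exact ⟨r + 1, Fin.cons a q, by simp [Fin.sum_univ_succ, sq]⟩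

theorem IsSumSq.algebraMap_mul {R : Type*} [CommRing R] [Algebra ℝ R] {c : ℝ} (hc : 0 ≤ c)
    {p : R} (hp : IsSumSq p) : IsSumSq (algebraMap ℝ R c * p) := by
  refine IsSumSq.mul ?_ hp
  rw [← Real.mul_self_sqrt hc, map_mul]
  exact IsSumSq.mul_self _

/-- Division of a sum of squares by a positive natural number. -/
theorem IsSumSq.of_natCast_mul {R : Type*} [CommRing R] [Algebra ℝ R] {k : ℕ} (hk : 0 < k)
    {p : R} (hp : IsSumSq ((k : R) * p)) : IsSumSq p := by
  have hk' : (k : ℝ) ≠ 0 := by positivity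
  have h := hp.algebraMap_mul (c := (k : ℝ)⁻¹) (by positivity)
  rwa [← mul_assoc, ← map_natCast (algebraMap ℝ R) k, ← map_mul, inv_mul_cancel₀ hk', map_one,
    one_mul] at h

theorem isSumSq_pow_sub_mul_sub {R : Type*} [CommRing R] (a b : R) (k : ℕ) :
    IsSumSq (((a ^ 2) ^ k - (b ^ 2) ^ k) * (a ^ 2 - b ^ 2)) := by
  rw [← geom_sum₂_mul, mul_assoc]
  refine IsSumSq.mul (IsSumSq.sum fun i _ => ?_) (IsSumSq.mul_self _)
  rw [← pow_mul, ← pow_mul, mul_comm 2 i, mul_comm 2, pow_mul, pow_mul]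
  exact IsSumSq.mul (IsSquare.sq _).isSumSq (IsSquare.sq _).isSumSq

/-- The arithmetic-geometric mean inequality for squares, as a sum of squares. -/
theorem isSumSq_amgm_sq {R ι : Type*} [CommRing R] [Algebra ℝ R] [DecidableEq ι] (x : ι → R)
    (d : ℕ) : ∀ s : Finset ι, s.card = d →
    IsSumSq (∑ j ∈ s, (x j ^ 2) ^ d - (d : R) * ∏ j ∈ s, x j ^ 2) := by
  induction d with
  | zero => intro s hs; simp [Finset.card_eq_zero.mp hs, IsSumSq.zero]
  | succ d ih =>
    intro s hs
    rcases Nat.eq_zero_or_pos d with rfl | hd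
    · obtain ⟨a, rfl⟩ := Finset.card_eq_one.mp hs
      simp [IsSumSq.zero]
    have hcard : ∀ j ∈ s, (s.erase j).card = d := fun j hj => by
      rw [Finset.card_erase_of_mem hj, hs]; rfl
    have h1 : IsSumSq (∑ j ∈ s, x j ^ 2 *
        (∑ k ∈ s.erase j, (x k ^ 2) ^ d - (d : R) * ∏ k ∈ s.erase j, x k ^ 2)) :=
      IsSumSq.sum fun j hj => IsSumSq.mul (IsSquare.sq _).isSumSq (ih _ (hcard j hj))
    have h2 : IsSumSq (∑ j ∈ s, ∑ k ∈ s,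
        ((x j ^ 2) ^ d - (x k ^ 2) ^ d) * (x j ^ 2 - x k ^ 2)) :=
      IsSumSq.sum fun j _ => IsSumSq.sum fun k _ => isSumSq_pow_sub_mul_sub _ _ _
    have e1 : ∑ j ∈ s, x j ^ 2 *
        (∑ k ∈ s.erase j, (x k ^ 2) ^ d - (d : R) * ∏ k ∈ s.erase j, x k ^ 2)
        = (∑ j ∈ s, x j ^ 2) * (∑ k ∈ s, (x k ^ 2) ^ d) - ∑ j ∈ s, (x j ^ 2) ^ (d + 1)
          - ((d + 1 : ℕ) : R) * (d : R) * ∏ k ∈ s, x k ^ 2 := by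
      have : ∀ j ∈ s, x j ^ 2 *
          (∑ k ∈ s.erase j, (x k ^ 2) ^ d - (d : R) * ∏ k ∈ s.erase j, x k ^ 2)
          = x j ^ 2 * (∑ k ∈ s, (x k ^ 2) ^ d) - (x j ^ 2) ^ (d + 1)
            - (d : R) * ∏ k ∈ s, x k ^ 2 := by
        intro j hj
        rw [← Finset.add_sum_erase s _ hj, ← Finset.mul_prod_erase s _ hj]
        ring
      rw [Finset.sum_congr rfl this, Finset.sum_sub_distrib, Finset.sum_sub_distrib,
        Finset.sum_const, hs, ← Finset.sum_mul, nsmul_eq_mul]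
      ring
    have e2 : ∑ j ∈ s, ∑ k ∈ s, ((x j ^ 2) ^ d - (x k ^ 2) ^ d) * (x j ^ 2 - x k ^ 2)
        = 2 * (((d + 1 : ℕ) : R) * ∑ j ∈ s, (x j ^ 2) ^ (d + 1)
          - (∑ j ∈ s, x j ^ 2) * (∑ k ∈ s, (x k ^ 2) ^ d)) := by
      have : ∀ j ∈ s, ∑ k ∈ s, ((x j ^ 2) ^ d - (x k ^ 2) ^ d) * (x j ^ 2 - x k ^ 2)
          = ((d + 1 : ℕ) : R) * (x j ^ 2) ^ (d + 1) + ∑ k ∈ s, (x k ^ 2) ^ (d + 1)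
            - (x j ^ 2) ^ d * (∑ k ∈ s, x k ^ 2) - x j ^ 2 * ∑ k ∈ s, (x k ^ 2) ^ d := by
        intro j _
        rw [← nsmul_eq_mul, ← hs, ← Finset.sum_const, hs, Finset.mul_sum, Finset.mul_sum,
          ← Finset.sum_add_distrib, ← Finset.sum_sub_distrib, ← Finset.sum_sub_distrib]
        refine Finset.sum_congr rfl fun k _ => ?_
        ring
      rw [Finset.sum_congr rfl this, Finset.sum_sub_distrib, Finset.sum_sub_distrib,
        Finset.sum_add_distrib, Finset.sum_const, hs, ← Finset.sum_mul, ← Finset.sum_mul,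
        ← Finset.mul_sum, nsmul_eq_mul]
      ring
    rw [e1] at h1
    rw [e2] at h2
    have h3 : IsSumSq (((∑ j ∈ s, (x j ^ 2) ^ (d + 1)) * ((d + 1 : ℕ) : R)
          - (∑ j ∈ s, x j ^ 2) * (∑ k ∈ s, (x k ^ 2) ^ d))) :=
      IsSumSq.of_natCast_mul (k := 2) two_pos 
        (h2.of_eq (by push_cast; ring))
    refine IsSumSq.of_natCast_mul hd ?_
    refine (h1.add h3).of_eq ?_
    push_cast
    ring

/-- The arithmetic-geometric mean inequality of even degree, as a sum of squares (Hurwitz). -/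
theorem isSumSq_amgm {R : Type*} [CommRing R] [Algebra ℝ R] {M : ℕ} (hM : Even M)
    (x : Fin M → R) : IsSumSq (∑ j, x j ^ M - (M : R) * ∏ j, x j) := by
  obtain ⟨d, rfl⟩ := hM
  have h (y : Fin d → R) := isSumSq_amgm_sq y d Finset.univ (by simp)
  have h1 := h fun j => x (Fin.castAdd d j)
  have h2 := h fun j => x (Fin.natAdd d j)
  have h3 := (IsSumSq.natCast (R := R) d).mul (IsSumSq.mul_self
    (∏ j, x (Fin.castAdd d j) - ∏ j, x (Fin.natAdd d j)))
  refine ((h1.add h2).add h3).of_eq ?_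
  rw [Fin.sum_univ_add, Fin.prod_univ_add]
  simp only [← pow_mul, Finset.prod_pow, two_mul]
  push_cast
  ring

/-- Weighted form of `isSumSq_amgm`, allowing a change of signs of the variables. -/
theorem isSumSq_weighted_amgm {R : Type*} [CommRing R] [Algebra ℝ R] {M : ℕ} (hM : Even M)
    (hpos : 0 < M) (x : Fin M → R) (w : Fin M → ℝ) (hw : ∀ j, 0 ≤ w j) (c : ℝ) (e : Fin M → ℤˣ)
    (hc : 0 ≤ c * ∏ j, ((e j : ℤ) : ℝ)) (hprod : ∏ j, ((M : ℝ) * w j) = |c| ^ M) :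
    IsSumSq (∑ j, algebraMap ℝ R (w j) * x j ^ M - algebraMap ℝ R c * ∏ j, x j) := by
  have hM0 : (M : ℝ) ≠ 0 := by positivity
  have he : ∀ j, (((e j : ℤ) : ℝ)) ^ M = 1 := fun j => by
    rcases Int.units_eq_one_or (e j) with h | h <;> simp [h, hM.neg_one_pow]
  have heabs : |∏ j, ((e j : ℤ) : ℝ)| = 1 := by
    rw [Finset.abs_prod]
    refine Finset.prod_eq_one fun j _ => ?_
    rcases Int.units_eq_one_or (e j) with h | h <;> simp [h]
  have hce : (∏ j, ((e j : ℤ) : ℝ)) * |c| = c := by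
    have h1 : c * ∏ j, ((e j : ℤ) : ℝ) = |c| := by
      rw [← abs_of_nonneg hc, abs_mul, heabs, mul_one]
    rw [← h1, mul_comm, mul_assoc, ← sq, ← sq_abs, heabs]
    simp
  have hroot : ∏ j, ((M : ℝ) * w j) ^ (M : ℝ)⁻¹ = |c| := by
    rw [Real.finsetProd_rpow _ _ (fun j _ => by have := hw j; positivity), hprod,
      Real.pow_rpow_inv_natCast (abs_nonneg c) hpos.ne']
  have h := isSumSq_amgm hM fun j =>
    algebraMap ℝ R (((e j : ℤ) : ℝ) * ((M : ℝ) * w j) ^ (M : ℝ)⁻¹) * x j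
  have e1 : ∀ j, (algebraMap ℝ R (((e j : ℤ) : ℝ) * ((M : ℝ) * w j) ^ (M : ℝ)⁻¹) * x j) ^ M
      = (M : R) * (algebraMap ℝ R (w j) * x j ^ M) := fun j => by
    rw [mul_pow, ← map_pow, mul_pow, he, one_mul,
      Real.rpow_inv_natCast_pow (by have := hw j; positivity) hpos.ne', map_mul, map_natCast,
      mul_assoc]
  have e2 : ∏ j, (algebraMap ℝ R (((e j : ℤ) : ℝ) * ((M : ℝ) * w j) ^ (M : ℝ)⁻¹) * x j)
      = algebraMap ℝ R c * ∏ j, x j := by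
    rw [Finset.prod_mul_distrib, ← map_prod, Finset.prod_mul_distrib, hroot, hce]
  simp only [e1, e2, ← Finset.mul_sum, ← mul_sub] at h
  exact h.of_natCast_mul hpos

theorem abs_le_exp_sub_self (s : ℝ) : |s| ≤ Real.exp s - s := by
  rcases le_total 0 s with h | h
  · rw [abs_of_nonneg h]
    nlinarith [Real.quadratic_le_exp_of_nonneg h, sq_nonneg (s - 1)]
  · rw [abs_of_nonpos h]
    linarith [Real.exp_pos s]

/-- Monomial weights obtained from the stationarity of a log-barrier function. -/
theorem exists_weights_of_pos {ι K : Type*} [Fintype ι] [Nonempty ι] [DecidableEq ι] [Fintype K]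
    {M : ℕ} (hM : 0 < M) (g : K → Fin M → ι) (c : K → ℝ) (hc : ∀ k, 0 ≤ c k) (d : ι → ℝ) (L : ℝ)
    (hL : ∀ x : ι → ℝ, (∀ i, 0 ≤ x i) →
      ∑ i, d i * x i ^ M + ∑ k, c k * ∏ j, x (g k j) ≤ L * ∑ i, x i ^ M)
    {ε : ℝ} (hε : 0 < ε) :
    ∃ w : K → Fin M → ℝ, (∀ k j, 0 ≤ w k j) ∧ (∀ k, ∏ j, ((M : ℝ) * w k j) = c k ^ M) ∧
      ∀ i, d i + ∑ k, ∑ j, (if g k j = i then w k j else 0) ≤ L + ε := by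
  have hM' : (0 : ℝ) < M := by exact_mod_cast hM
  set Ψ : (ι → ℝ) → ℝ := fun u => ∑ i, ((L + ε - d i) * Real.exp (M * u i) - ε * (M * u i))
    - ∑ k, c k * Real.exp (∑ j, u (g k j)) with hΨ
  have hlow : ∀ u, ε * M * ‖u‖ ≤ Ψ u := by
    intro u
    have h1 := hL (fun i => Real.exp (u i)) fun i => (Real.exp_pos _).le
    simp only [← Real.exp_nat_mul, ← Real.exp_sum] at h1
    have h2 : ε * M * ‖u‖ ≤ ∑ i, ε * (Real.exp (M * u i) - M * u i) := by
      rw [← Finset.mul_sum, mul_assoc]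
      refine mul_le_mul_of_nonneg_left ?_ hε.le
      have hterm : ∀ j, 0 ≤ Real.exp (M * u j) - M * u j := fun j =>
        (abs_nonneg _).trans (abs_le_exp_sub_self _)
      rw [← le_div_iff₀' hM']
      refine (pi_norm_le_iff_of_nonneg
        (div_nonneg (Finset.sum_nonneg fun j _ => hterm j) hM'.le)).2 fun i => ?_
      rw [le_div_iff₀' hM', Real.norm_eq_abs, ← abs_of_pos hM', ← abs_mul, abs_of_pos hM']
      exact (abs_le_exp_sub_self _).trans (Finset.single_le_sum
        (f := fun i => Real.exp (M * u i) - M * u i) (fun j _ => hterm j) (Finset.mem_univ i))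
    have h4 : Ψ u = ∑ i, ε * (Real.exp (M * u i) - M * u i) + (L * ∑ i, Real.exp (M * u i)
        - (∑ i, d i * Real.exp (M * u i) + ∑ k, c k * Real.exp (∑ j, u (g k j)))) := by
      rw [hΨ, Finset.mul_sum, ← sub_sub, ← Finset.sum_sub_distrib, ← add_sub_assoc,
        ← Finset.sum_add_distrib]
      refine congrArg₂ _ (Finset.sum_congr rfl fun i _ => ?_) rfl
      ring
    linarith
  have hcont : Continuous Ψ := by fun_prop
  have htend : Filter.Tendsto Ψ (Filter.cocompact _) Filter.atTop :=
    Filter.tendsto_atTop_mono hlow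
      ((tendsto_norm_cocompact_atTop).const_mul_atTop (by positivity))
  obtain ⟨u, hu⟩ := hcont.exists_forall_le htend
  have hder : ∀ i, (L + ε - d i) * (Real.exp (M * u i) * M) - ε * M
      - ∑ k, c k * (Real.exp (∑ j, u (g k j)) * ∑ j, (if g k j = i then 1 else 0)) = 0 := by
    intro i
    have hcoord : ∀ i', HasDerivAt (fun t : ℝ => u i' + t * (if i' = i then 1 else 0))
        (if i' = i then 1 else 0) 0 := fun i' => by
      simpa using
        ((hasDerivAt_id (0 : ℝ)).mul_const (if i' = i then (1 : ℝ) else 0)).const_add (u i')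
    have h1 : HasDerivAt (fun t : ℝ => Ψ fun i' => u i' + t * (if i' = i then 1 else 0))
        (∑ i', ((L + ε - d i') * (Real.exp (M * (u i' + 0 * (if i' = i then 1 else 0)))
            * (M * (if i' = i then 1 else 0))) - ε * (M * (if i' = i then 1 else 0)))
          - ∑ k, c k * (Real.exp (∑ j, (u (g k j) + 0 * (if g k j = i then 1 else 0)))
            * ∑ j, (if g k j = i then 1 else 0))) 0 := by
      refine HasDerivAt.sub (HasDerivAt.fun_sum fun i' _ => ?_) (HasDerivAt.fun_sum fun k _ => ?_)
      · exact ((((hcoord i').const_mul (M : ℝ)).exp).const_mul _).sub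
          (((hcoord i').const_mul (M : ℝ)).const_mul _)
      · exact ((HasDerivAt.fun_sum fun j _ => hcoord (g k j)).exp).const_mul _
    have h2 := IsLocalMin.hasDerivAt_eq_zero (Filter.Eventually.of_forall fun t => by
      simpa using hu _) h1
    simpa [Finset.sum_sub_distrib] using h2
  refine ⟨fun k j => c k * Real.exp (∑ j', u (g k j') - M * u (g k j)) / M,
    fun k j => div_nonneg (mul_nonneg (hc k) (Real.exp_pos _).le) hM'.le, fun k => ?_,
    fun i => ?_⟩
  · have h1 : ∀ j, (M : ℝ) * (c k * Real.exp (∑ j', u (g k j') - M * u (g k j)) / M)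
        = c k * Real.exp (∑ j', u (g k j') - M * u (g k j)) := fun j => by field_simp
    simp only [h1]
    rw [Finset.prod_mul_distrib, ← Real.exp_sum, Finset.sum_sub_distrib, ← Finset.mul_sum]
    simp
  · have h1 : ∑ k, ∑ j, (if g k j = i then
          c k * Real.exp (∑ j', u (g k j') - M * u (g k j)) / M else 0)
        = (∑ k, c k * (Real.exp (∑ j, u (g k j)) * ∑ j, (if g k j = i then 1 else 0)))
          * (Real.exp (-(M * u i)) / M) := by
      rw [Finset.sum_mul]
      refine Finset.sum_congr rfl fun k _ => ?_
      rw [Finset.mul_sum, Finset.mul_sum, Finset.sum_mul]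
      refine Finset.sum_congr rfl fun j _ => ?_
      split_ifs with h
      · rw [h, sub_eq_add_neg, Real.exp_add]; ring
      · simp
    have h2 : ∑ k, c k * (Real.exp (∑ j, u (g k j)) * ∑ j, (if g k j = i then 1 else 0))
        = (L + ε - d i) * (Real.exp (M * u i) * M) - ε * M := by linarith [hder i]
    have h3 : Real.exp (M * u i) * Real.exp (-(M * u i)) = 1 := by
      rw [← Real.exp_add]; simp
    have h4 : ((L + ε - d i) * (Real.exp (M * u i) * M) - ε * M) * (Real.exp (-(M * u i)) / M)
        = (L + ε - d i) * (Real.exp (M * u i) * Real.exp (-(M * u i)))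
          - ε * Real.exp (-(M * u i)) := by field_simp
    rw [h1, h2, h4, h3]
    nlinarith [Real.exp_pos (-(M * u i))]

/-- If a form whose off-diagonal coefficients are nonnegative is bounded on the nonnegative orthant
by `L ∑ x_i ^ M`, then `L` can be split into weights dominating each monomial separately. -/
theorem exists_weights {ι K : Type*} [Fintype ι] [Nonempty ι] [DecidableEq ι] [Fintype K]
    {M : ℕ} (hM : 0 < M) (g : K → Fin M → ι) (c : K → ℝ) (hc : ∀ k, 0 ≤ c k) (d : ι → ℝ) (L : ℝ)
    (hL : ∀ x : ι → ℝ, (∀ i, 0 ≤ x i) →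
      ∑ i, d i * x i ^ M + ∑ k, c k * ∏ j, x (g k j) ≤ L * ∑ i, x i ^ M) :
    ∃ w : K → Fin M → ℝ, (∀ k j, 0 ≤ w k j) ∧ (∀ k, ∏ j, ((M : ℝ) * w k j) = c k ^ M) ∧
      ∀ i, d i + ∑ k, ∑ j, (if g k j = i then w k j else 0) ≤ L := by
  have hstep : ∀ N : ℕ, (0 : ℝ) < 1 / ((N : ℝ) + 1) := fun N => Nat.one_div_pos_of_nat
  choose w hw0 hwp hwL using fun N : ℕ => exists_weights_of_pos hM g c hc d L hL (hstep N)
  have hbox : ∀ N, w N ∈ Set.Icc (0 : K → Fin M → ℝ) fun k j => L + 1 - d (g k j) := by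
    intro N
    refine ⟨fun k j => hw0 N k j, fun k j => ?_⟩
    have h1 := hwL N (g k j)
    have hnn : ∀ k' j', 0 ≤ (if g k' j' = g k j then w N k' j' else 0) := fun k' j' => by
      split_ifs
      exacts [hw0 N k' j', le_rfl]
    have h2 : w N k j ≤ ∑ k', ∑ j', (if g k' j' = g k j then w N k' j' else 0) := by
      refine le_trans ?_ (Finset.single_le_sum
        (fun k' _ => Finset.sum_nonneg fun j' _ => hnn k' j') (Finset.mem_univ k))
      refine le_trans ?_ (Finset.single_le_sum (fun j' _ => hnn k j') (Finset.mem_univ j))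
      simp
    have h3 : 1 / ((N : ℝ) + 1) ≤ 1 := by
      rw [div_le_one (by positivity)]
      linarith [(Nat.cast_nonneg N : (0 : ℝ) ≤ N)]
    change w N k j ≤ L + 1 - d (g k j)
    linarith
  obtain ⟨a, ha, φ, hφ, hlim⟩ := isCompact_Icc.tendsto_subseq hbox
  refine ⟨a, fun k j => ha.1 k j, fun k => ?_, fun i => ?_⟩
  · have hcont : Continuous fun v : K → Fin M → ℝ => ∏ j, ((M : ℝ) * v k j) := by fun_prop
    refine tendsto_nhds_unique ((hcont.tendsto a).comp hlim) ?_
    simp only [Function.comp_def, hwp]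
    exact tendsto_const_nhds
  · have hcont : Continuous fun v : K → Fin M → ℝ =>
        d i + ∑ k, ∑ j, (if g k j = i then v k j else 0) := by
      refine continuous_const.add (continuous_finsetSum _ fun k _ =>
        continuous_finsetSum _ fun j _ => ?_)
      split_ifs
      · fun_prop
      · exact continuous_const
    have hup : Filter.Tendsto (fun N => L + 1 / (((φ N : ℕ) : ℝ) + 1)) Filter.atTop
        (nhds (L + 0)) :=
      (tendsto_one_div_add_atTop_nhds_zero_nat.comp hφ.tendsto_atTop).const_add L
    rw [add_zero] at hup
    exact le_of_tendsto_of_tendsto' ((hcont.tendsto a).comp hlim) hup fun N => hwL (φ N) i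

theorem tmul_smul {m n : ℕ} (A : (Fin m → Fin n) → ℝ) (r : ℝ) (x : Fin n → ℝ) :
    tmul A (fun i => r * x i) = r ^ m * tmul A x := by
  simp only [tmul, Finset.prod_mul_distrib, Finset.prod_const, Finset.card_univ, Fintype.card_fin,
    Finset.mul_sum]
  exact Finset.sum_congr rfl fun g _ => by ring

theorem tmul_eq_sum_cons {m n : ℕ} (A : (Fin (m + 1) → Fin n) → ℝ) (x : Fin n → ℝ) :
    tmul A x = ∑ i, x i * ∑ g : Fin m → Fin n, A (Fin.cons i g) * ∏ j, x (g j) := by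
  rw [tmul, ← (Fin.consEquiv fun _ => Fin n).sum_comp, Fintype.sum_prod_type]
  refine Finset.sum_congr rfl fun i _ => ?_
  rw [Finset.mul_sum]
  refine Finset.sum_congr rfl fun g _ => ?_
  change A (Fin.cons i g) * ∏ j, x ((Fin.cons i g : Fin (m + 1) → Fin n) j) = _
  simp only [Fin.prod_univ_succ, Fin.cons_zero, Fin.cons_succ]
  ring

theorem sum_pow_pos {n M : ℕ} (hM : Even M) {x : Fin n → ℝ} (hx : x ≠ 0) : 0 < ∑ i, x i ^ M := by
  obtain ⟨i, hi⟩ := Function.ne_iff.mp hx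
  exact Finset.sum_pos' (fun j _ => hM.pow_nonneg _) ⟨i, Finset.mem_univ i, hM.pow_pos hi⟩

/-- The `i`-th partial derivative of the form of a symmetric tensor. -/
theorem hasDerivAt_tmul {m n : ℕ} (A : (Fin (m + 1) → Fin n) → ℝ) (hsym : IsSymT A)
    (x : Fin n → ℝ) (i : Fin n) :
    HasDerivAt (fun t : ℝ => tmul A fun i' => x i' + t * (if i' = i then 1 else 0))
      (((m + 1 : ℕ) : ℝ) * ∑ g : Fin m → Fin n, A (Fin.cons i g) * ∏ j, x (g j)) 0 := by
  have hcoord : ∀ i', HasDerivAt (fun t : ℝ => x i' + t * (if i' = i then 1 else 0))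
      (if i' = i then 1 else 0) 0 := fun i' => by
    simpa using ((hasDerivAt_id (0 : ℝ)).mul_const (if i' = i then (1 : ℝ) else 0)).const_add (x i')
  have h1 : HasDerivAt (fun t : ℝ => tmul A fun i' => x i' + t * (if i' = i then 1 else 0))
      (∑ g, A g * ∑ j, (∏ k ∈ Finset.univ.erase j, (x (g k) + 0 * (if g k = i then 1 else 0)))
        • (if g j = i then 1 else 0)) 0 :=
    HasDerivAt.fun_sum fun g _ =>
      (HasDerivAt.fun_finsetProd fun j _ => hcoord (g j)).const_mul (A g)
  refine h1.congr_deriv ?_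
  have h2 : ∀ j : Fin (m + 1), ∑ g : Fin (m + 1) → Fin n, A g *
      ((∏ k ∈ Finset.univ.erase j, x (g k)) * (if g j = i then 1 else 0))
      = ∑ g : Fin m → Fin n, A (Fin.cons i g) * ∏ k, x (g k) := by
    intro j
    rw [← (Fin.insertNthEquiv (fun _ => Fin n) j).sum_comp, Fintype.sum_prod_type]
    rw [Finset.sum_eq_single i]
    · refine Finset.sum_congr rfl fun g _ => ?_
      have h3 : A (j.insertNth i g) = A (Fin.cons i g) := by
        rw [← Fin.cons_comp_cycleRange, hsym]
      have h4 : ∏ k ∈ Finset.univ.erase j, x ((j.insertNth i g : Fin (m + 1) → Fin n) k)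
          = ∏ k, x (g k) := by
        rw [← Finset.compl_singleton, ← Fin.image_succAbove_univ,
          Finset.prod_image fun a _ b _ h => Fin.succAbove_right_injective h]
        simp
      simp only [Fin.insertNthEquiv_apply, Fin.insertNth_apply_same, if_true, mul_one]
      exact congrArg₂ _ h3 h4
    · intro i' _ hne
      simp [hne]
    · simp
  simp only [zero_mul, add_zero, smul_eq_mul, Finset.mul_sum]
  rw [Finset.sum_comm]
  simp only [h2, Finset.sum_const, Finset.card_univ, Fintype.card_fin, nsmul_eq_mul,
    ← Finset.mul_sum]

/-- The largest H-eigenvalue of a symmetric tensor of even order exists and equals the maximum of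
the form on the unit sphere of the `ℓ^(m+1)` norm. -/
theorem exists_isHEig_max {m n : ℕ} (hn : 0 < n) (heven : Even (m + 1))
    (A : (Fin (m + 1) → Fin n) → ℝ) (hsym : IsSymT A) :
    ∃ L : ℝ, IsHEig A L ∧ (∀ lam, IsHEig A lam → lam ≤ L) ∧
      (∀ x, tmul A x ≤ L * ∑ i, x i ^ (m + 1)) ∧
      ∃ x : Fin n → ℝ, ∑ i, x i ^ (m + 1) = 1 ∧ tmul A x = L := by
  have hcont : Continuous fun x : Fin n → ℝ => tmul A x := by unfold tmul; fun_prop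
  have hN : Continuous fun x : Fin n → ℝ => ∑ i, x i ^ (m + 1) := by fun_prop
  have hcomp : IsCompact {x : Fin n → ℝ | ∑ i, x i ^ (m + 1) = 1} := by
    refine Metric.isCompact_of_isClosed_isBounded (isClosed_eq hN continuous_const)
      ((Metric.isBounded_closedBall (x := (0 : Fin n → ℝ)) (r := 1)).subset fun x hx => ?_)
    rw [mem_closedBall_zero_iff, pi_norm_le_iff_of_nonneg zero_le_one]
    intro i
    have h1 : x i ^ (m + 1) ≤ 1 := by
      rw [← (show ∑ i, x i ^ (m + 1) = 1 from hx)]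
      exact Finset.single_le_sum (f := fun i => x i ^ (m + 1)) (fun j _ => heven.pow_nonneg _)
        (Finset.mem_univ i)
    rw [Real.norm_eq_abs]
    rw [← heven.pow_abs] at h1
    exact (pow_le_one_iff_of_nonneg (abs_nonneg _) m.succ_ne_zero).1 h1
  have hne : {x : Fin n → ℝ | ∑ i, x i ^ (m + 1) = 1}.Nonempty :=
    ⟨Pi.single ⟨0, hn⟩ 1, by simp [Pi.single_apply]⟩
  obtain ⟨x, hx, hmax⟩ := hcomp.exists_isMaxOn hne hcont.continuousOn
  have hx1 : ∑ i, x i ^ (m + 1) = 1 := hx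
  have hbound : ∀ y, tmul A y ≤ tmul A x * ∑ i, y i ^ (m + 1) := by
    intro y
    by_cases hy : y = 0
    · simp [hy, tmul]
    have hpos := sum_pow_pos heven hy
    set r := (∑ i, y i ^ (m + 1)) ^ (((m + 1 : ℕ) : ℝ)⁻¹) with hr
    have hrpos : 0 < r := Real.rpow_pos_of_pos hpos _
    have hrM : r ^ (m + 1) = ∑ i, y i ^ (m + 1) :=
      Real.rpow_inv_natCast_pow hpos.le m.succ_ne_zero
    have h1 : tmul A (fun i => r⁻¹ * y i) ≤ tmul A x := by
      refine hmax (show ∑ i, (r⁻¹ * y i) ^ (m + 1) = 1 from ?_)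
      simp only [mul_pow, ← Finset.mul_sum]
      rw [← hrM, inv_pow, inv_mul_cancel₀ (pow_pos hrpos _).ne']
    rwa [tmul_smul, inv_pow, hrM, inv_mul_le_iff₀ hpos, mul_comm] at h1
  refine ⟨tmul A x, ⟨x, ?_, fun i => ?_⟩, ?_, hbound, x, hx1, rfl⟩
  · rintro rfl
    simp at hx1
  · have hM : (((m + 1 : ℕ) : ℝ)) ≠ 0 := by positivity
    have hpow : HasDerivAt
        (fun t : ℝ => ∑ i', (x i' + t * (if i' = i then 1 else 0)) ^ (m + 1))
        (((m + 1 : ℕ) : ℝ) * x i ^ m) 0 := by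
      have h1 := HasDerivAt.fun_sum (u := (Finset.univ : Finset (Fin n))) fun i' _ =>
        (((hasDerivAt_id (0 : ℝ)).mul_const (if i' = i then (1 : ℝ) else 0)).const_add
          (x i')).fun_pow (m + 1)
      refine h1.congr_deriv ?_
      simp
    have h1 := (hpow.const_mul (tmul A x)).sub (hasDerivAt_tmul A hsym x i)
    have h2 := IsLocalMin.hasDerivAt_eq_zero (Filter.Eventually.of_forall fun t => by
      simpa [hx1] using hbound _) h1
    refine mul_left_cancel₀ hM ?_
    linarith
  · rintro lam ⟨y, hy, hev⟩
    have hpos := sum_pow_pos heven hy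
    have h1 : tmul A y = lam * ∑ i, y i ^ (m + 1) := by
      rw [tmul_eq_sum_cons, Finset.mul_sum]
      refine Finset.sum_congr rfl fun i _ => ?_
      rw [hev]
      ring
    exact le_of_mul_le_mul_right (h1 ▸ hbound y) hpos

/-- Along a family satisfying `WCondI`, local assignments that can be prescribed at one index
glue to a global one. -/
theorem exists_glued_assignment {n s : ℕ} {X : Type*} [Nonempty X] (Γ : Fin s → Finset (Fin n))
    (hI : WCondI Γ) (Q : Fin s → (Fin n → X) → Prop) (hn : 0 < n)
    (hloc : ∀ l f f', (∀ i ∈ Γ l, f i = f' i) → Q l f → Q l f')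
    (hext : ∀ l v a, ∃ f, Q l f ∧ f v = a) : ∃ f, ∀ l, Q l f := by
  have key : ∀ k : ℕ, k ≤ s → ∃ f, ∀ l : Fin s, (l : ℕ) < k → Q l f := by
    intro k
    induction k with
    | zero => exact fun _ => ⟨fun _ => Classical.arbitrary X, by simp⟩
    | succ k ih =>
      intro hk
      obtain ⟨f, hf⟩ := ih (by omega)
      set p : Fin s := ⟨k, hk⟩ with hp
      obtain ⟨v, hv⟩ : ∃ v, ∀ l : Fin s, (l : ℕ) < k → ∀ i ∈ Γ l, i ∈ Γ p → i = v := by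
        have hcard : (((Finset.univ.filter fun l => l < p).biUnion Γ) ∩ Γ p).card ≤ 1 := by
          rcases Nat.eq_zero_or_pos k with h0 | hpos
          · have : (Finset.univ.filter fun l => l < p) = ∅ := by
              refine Finset.filter_false_of_mem fun l _ hl => ?_
              have : (l : ℕ) < k := hl
              omega
            simp [this]
          · exact hI p hpos
        have : Nonempty (Fin n) := ⟨⟨0, hn⟩⟩
        obtain ⟨v, hv⟩ := Finset.card_le_one_iff_subset_singleton.mp hcard
        refine ⟨v, fun l hl i hil hip => Finset.mem_singleton.mp (hv ?_)⟩
        simp only [Finset.mem_inter, Finset.mem_biUnion, Finset.mem_filter, Finset.mem_univ,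
          true_and]
        exact ⟨⟨l, hl, hil⟩, hip⟩
      obtain ⟨h, hQ, hhv⟩ := hext p v (f v)
      refine ⟨fun i => if i ∈ Γ p then h i else f i, fun l hl => ?_⟩
      rcases Nat.lt_succ_iff_lt_or_eq.mp hl with hlt | heq
      · refine hloc l f _ (fun i hi => ?_) (hf l hlt)
        split_ifs with hip
        · rw [hv l hlt i hi hip, hhv]
        · rfl
      · rw [show l = p from Fin.ext heq]
        exact hloc p h _ (fun i hi => by simp [hi]) hQ
  obtain ⟨f, hf⟩ := key s le_rfl
  exact ⟨f, fun l => hf l l.2⟩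

theorem eval_subTpoly {m n : ℕ} (Γ : Finset (Fin n)) (B : (Fin m → Γ) → ℝ) (x : Fin n → ℝ) :
    MvPolynomial.eval (fun i : Γ => x i) (subTpoly Γ B) = subTmul Γ B x := by
  simp [subTpoly, subTmul, map_sum, map_prod]

open Classical in
theorem subTpoly_eq_diag_add {m n : ℕ} (Γ : Finset (Fin n)) (B : (Fin (m + 1) → Γ) → ℝ) :
    subTpoly Γ B = ∑ i : Γ, MvPolynomial.C (B fun _ => i) * MvPolynomial.X i ^ (m + 1)
      + ∑ g : Fin (m + 1) → Γ, MvPolynomial.C (if NotDiag g then B g else 0)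
        * ∏ j, MvPolynomial.X (g j) := by
  rw [subTpoly, ← Finset.sum_filter_not_add_sum_filter Finset.univ NotDiag]
  refine congrArg₂ _ (Eq.symm ?_) ?_
  · refine Finset.sum_bij (fun i _ => fun _ => i) (fun i _ => by simp [NotDiag])
      (fun i _ i' _ h => congrFun h 0) (fun g hg => ?_) (fun i _ => by simp)
    refine ⟨g 0, Finset.mem_univ _, ?_⟩
    simp only [NotDiag, not_not, Finset.mem_filter] at hg
    exact funext fun j => hg.2 0 j
  · rw [Finset.sum_filter]
    refine Finset.sum_congr rfl fun g _ => ?_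
    split_ifs <;> simp

/-- A sign pattern with a prescribed value at one index that makes a given monomial with an odd
exponent negative. -/
theorem exists_signs_prod_eq_neg_one {I J : Type*} [DecidableEq I] [Fintype J]
    (hJ : Even (Fintype.card J)) (g : J → I) (i₀ : I)
    (hodd : Odd (Finset.univ.filter fun j => g j = i₀).card) (v : I) (a : ℤˣ) :
    ∃ h : I → ℤˣ, ∏ j, h (g j) = -1 ∧ h v = a := by
  have key : ∀ b : ℤˣ, ∏ j, (b * if g j = i₀ then -1 else 1) = -1 := by
    intro b
    obtain ⟨k, hk⟩ := hJ
    rw [Finset.prod_mul_distrib, Finset.prod_const, Finset.card_univ, hk, pow_add,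
      Int.units_mul_self, one_mul, Finset.prod_ite, Finset.prod_const_one, mul_one,
      Finset.prod_const, hodd.neg_one_pow]
  by_cases hv : v = i₀
  · exact ⟨fun i => -a * if i = i₀ then -1 else 1, key _, by simp [hv]⟩
  · exact ⟨fun i => a * if i = i₀ then -1 else 1, key _, by simp [hv]⟩

/-- Off-diagonal part of a subtensor of a W-tensor: either its coefficients can be made nonnegative
by changing signs of the variables, with one sign prescribed, or it is minus a sum of squares
vanishing at all vectors with at most one nonzero entry. -/
theorem WCondIII.exists_normal_form {m n : ℕ} (heven : Even (m + 1)) {Γ : Finset (Fin n)}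
    {B : (Fin (m + 1) → Γ) → ℝ} (hB : WCondIII B) :
    ∃ (c : (Fin (m + 1) → Γ) → ℝ) (r : MvPolynomial Γ ℝ),
      subTpoly Γ B = ∑ i : Γ, MvPolynomial.C (B fun _ => i) * MvPolynomial.X i ^ (m + 1)
        + ∑ g, MvPolynomial.C (c g) * ∏ j, MvPolynomial.X (g j) - r ∧
      IsSumSq r ∧
      (∀ (v : Fin n) (a : ℤˣ), ∃ h : Fin n → ℤˣ,
        (∀ g, 0 ≤ c g * ∏ j, ((h (g j) : ℤ) : ℝ)) ∧ h v = a) ∧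
      (r = 0 ∨ (c = 0 ∧ ∀ x : Γ → ℝ, (∀ i i', x i ≠ 0 → x i' ≠ 0 → i = i') →
        MvPolynomial.eval x r = 0)) := by
  classical
  have hconst : ∀ a : ℤˣ, ∏ _j : Fin (m + 1), ((a : ℤ) : ℝ) = 1 := by
    intro a
    rcases Int.units_eq_one_or a with h | h <;> simp [h, heven.neg_one_pow]
  rw [subTpoly_eq_diag_add]
  rcases hB with ⟨gb, hgb, hzero⟩ | hnn
  · set T : ℝ := ∑ g : Fin (m + 1) → Γ, if NotDiag g then B g else 0 with hT
    have hsum : ∑ g : Fin (m + 1) → Γ, (MvPolynomial.C (if NotDiag g then B g else 0)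
        * ∏ j, MvPolynomial.X (g j) : MvPolynomial Γ ℝ)
        = MvPolynomial.C T * ∏ j, MvPolynomial.X (gb j) := by
      rw [hT, map_sum, Finset.sum_mul]
      refine Finset.sum_congr rfl fun g _ => ?_
      by_cases hg : NotDiag g ∧ B g ≠ 0
      · have : ∃ σ : Equiv.Perm (Fin (m + 1)), g = gb ∘ σ := by
          by_contra hcon
          exact hg.2 (hzero g hg.1 fun σ h => hcon ⟨σ, h⟩)
        obtain ⟨σ, rfl⟩ := this
        rw [← Equiv.prod_comp σ fun j => (MvPolynomial.X (gb j) : MvPolynomial Γ ℝ)]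
        rfl
      · have : (if NotDiag g then B g else 0) = 0 := by
          split_ifs with h
          · by_contra hne
            exact hg ⟨h, hne⟩
          · rfl
        simp [this]
    have hsingle : ∑ g : Fin (m + 1) → Γ, (MvPolynomial.C (if g = gb then T else 0)
        * ∏ j, MvPolynomial.X (g j) : MvPolynomial Γ ℝ)
        = MvPolynomial.C T * ∏ j, MvPolynomial.X (gb j) := by
      rw [Finset.sum_eq_single gb (fun g _ hg => by simp [hg]) (by simp)]
      simp
    rw [hsum]
    by_cases hsgn : ∀ (v : Fin n) (a : ℤˣ), ∃ h : Fin n → ℤˣ,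
        0 ≤ T * ∏ j, ((h (gb j) : ℤ) : ℝ) ∧ h v = a
    · refine ⟨fun g => if g = gb then T else 0, 0, by rw [hsingle, sub_zero], IsSumSq.zero,
        fun v a => ?_, Or.inl rfl⟩
      obtain ⟨h, hh, hv⟩ := hsgn v a
      refine ⟨h, fun g => ?_, hv⟩
      beta_reduce
      split_ifs with hg
      · rw [hg]; exact hh
      · simp
    have hTneg : T < 0 := by
      by_contra hTnn
      refine hsgn fun v a => ⟨fun _ => a, ?_, rfl⟩
      rw [hconst a, mul_one]
      exact not_lt.mp hTnn
    have hev : ∀ i : Γ, Even (Finset.univ.filter fun j => gb j = i).card := by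
      intro i
      by_contra hodd
      rw [Nat.not_even_iff_odd] at hodd
      refine hsgn fun v a => ?_
      obtain ⟨h, hh, hv⟩ := exists_signs_prod_eq_neg_one (by simpa using heven)
        (fun j => (gb j : Fin n)) (i : Fin n) (by simpa only [Subtype.ext_iff] using hodd) v a
      refine ⟨h, ?_, hv⟩
      have : ∏ j, ((h (gb j) : ℤ) : ℝ) = -1 := by
        have := congrArg (fun z : ℤˣ => ((z : ℤ) : ℝ)) hh
        simpa [Units.coe_prod] using this
      rw [this]
      linarith
    refine ⟨0, MvPolynomial.C (-T) * ∏ j, MvPolynomial.X (gb j), by simp, ?_, fun v a =>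
      ⟨fun _ => a, by simp, rfl⟩, Or.inr ⟨rfl, fun x hx => ?_⟩⟩
    · refine IsSumSq.algebraMap_mul (by linarith) ?_
      rw [Finset.prod_comp (fun i => (MvPolynomial.X i : MvPolynomial Γ ℝ)) gb]
      exact IsSumSq.prod fun i _ => ((hev i).isSquare_pow _).isSumSq
    · have hgb' : ∃ j j', gb j ≠ gb j' := by
        simpa [NotDiag] using hgb
      obtain ⟨j, j', hjj⟩ := hgb'
      rw [map_mul, map_prod]
      by_cases hj : x (gb j) = 0
      · rw [Finset.prod_eq_zero (Finset.mem_univ j) (by simpa using hj), mul_zero]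
      by_cases hj' : x (gb j') = 0
      · rw [Finset.prod_eq_zero (Finset.mem_univ j') (by simpa using hj'), mul_zero]
      exact absurd (hx _ _ hj hj') hjj
  · refine ⟨fun g => if NotDiag g then B g else 0, 0, by rw [sub_zero], IsSumSq.zero,
      fun v a => ⟨fun _ => a, fun g => ?_, rfl⟩, Or.inl rfl⟩
    rw [hconst a, mul_one]
    beta_reduce
    split_ifs with hg
    · exact hnn g hg
    · exact le_rfl

/-- The coefficient of `x_i ^ (m + 1)` in the form of a subtensor. -/
def diagCoeff {m n : ℕ} (Γ : Finset (Fin n)) (B : (Fin (m + 1) → Γ) → ℝ) (i : Fin n) : ℝ :=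
  if h : i ∈ Γ then B fun _ => ⟨i, h⟩ else 0

theorem sum_diag_eq {m n : ℕ} (Γ : Finset (Fin n)) (B : (Fin (m + 1) → Γ) → ℝ) (ψ : Fin n → ℝ) :
    ∑ i : Γ, B (fun _ => i) * ψ i = ∑ i, diagCoeff Γ B i * ψ i := by
  rw [← Finset.sum_subset (Finset.subset_univ Γ) fun i _ hi => by simp [diagCoeff, hi],
    ← Finset.sum_coe_sort Γ]
  exact Finset.sum_congr rfl fun i _ => by simp [diagCoeff]

/-- Splitting a vector along the fibres of a map and changing signs reduces the form with
nonnegative off-diagonal coefficients to the form of the W-tensor. -/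
theorem sum_abs_le_of_tmul_le {m n s : ℕ} (heven : Even (m + 1))
    (A : (Fin (m + 1) → Fin n) → ℝ)
    (Γ : Fin s → Finset (Fin n)) (B : ∀ l : Fin s, (Fin (m + 1) → Γ l) → ℝ)
    (hII : ∀ x : Fin n → ℝ, tmul A x = ∑ l, subTmul (Γ l) (B l) x)
    (c : ∀ l, (Fin (m + 1) → Γ l) → ℝ) (r : ∀ l, MvPolynomial (Γ l) ℝ)
    (heq : ∀ l, subTpoly (Γ l) (B l)
      = ∑ i : Γ l, MvPolynomial.C (B l fun _ => i) * MvPolynomial.X i ^ (m + 1)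
        + ∑ g, MvPolynomial.C (c l g) * ∏ j, MvPolynomial.X (g j) - r l)
    (σ : Fin n → ℤˣ) (hσ : ∀ l g, 0 ≤ c l g * ∏ j, ((σ (g j) : ℤ) : ℝ))
    (col : Fin n → Fin n)
    (hcol : ∀ l, (r l = 0 ∧ ∀ i ∈ Γ l, ∀ i' ∈ Γ l, col i = col i') ∨
      (c l = 0 ∧ Set.InjOn col (Γ l) ∧ ∀ x : Γ l → ℝ, (∀ i i', x i ≠ 0 → x i' ≠ 0 → i = i') →
        MvPolynomial.eval x (r l) = 0))
    (L : ℝ) (hL : ∀ x, tmul A x ≤ L * ∑ i, x i ^ (m + 1)) (x : Fin n → ℝ) :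
    ∑ i, (∑ l, diagCoeff (Γ l) (B l) i) * x i ^ (m + 1)
      + ∑ k : (Σ l, (Fin (m + 1) → Γ l)), |c k.1 k.2| * ∏ j, x (k.2 j) ≤
      L * ∑ i, x i ^ (m + 1) := by
  set y : Fin n → Fin n → ℝ := fun κ i => if col i = κ then x i else 0 with hy
  have hσabs : ∀ i, |((σ i : ℤ) : ℝ)| = 1 := fun i => by
    rcases Int.units_eq_one_or (σ i) with h | h <;> simp [h]
  have hσpow : ∀ i, ((σ i : ℤ) : ℝ) ^ (m + 1) = 1 := fun i => by
    rw [← heven.pow_abs, hσabs, one_pow]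
  have hcσ : ∀ l g, c l g * ∏ j, ((σ (g j) : ℤ) : ℝ) = |c l g| := fun l g => by
    rw [← abs_of_nonneg (hσ l g), abs_mul, Finset.abs_prod]
    simp [hσabs]
  have hpiece : ∀ κ, ∑ i, (∑ l, diagCoeff (Γ l) (B l) i) * y κ i ^ (m + 1)
      + ∑ l, ∑ g, |c l g| * ∏ j, y κ (g j) ≤ L * ∑ i, y κ i ^ (m + 1) := by
    intro κ
    have h1 := hL fun i => ((σ i : ℤ) : ℝ) * y κ i
    have h2 : ∀ l, subTmul (Γ l) (B l) (fun i => ((σ i : ℤ) : ℝ) * y κ i)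
        = ∑ i, diagCoeff (Γ l) (B l) i * y κ i ^ (m + 1) + ∑ g, |c l g| * ∏ j, y κ (g j) := by
      intro l
      have hr : MvPolynomial.eval (fun i : Γ l => ((σ i : ℤ) : ℝ) * y κ i) (r l) = 0 := by
        rcases hcol l with ⟨h0, -⟩ | ⟨-, hinj, hvan⟩
        · rw [h0, map_zero]
        · refine hvan _ fun i i' hi hi' => Subtype.ext (hinj i.2 i'.2 ?_)
          have h3 : ∀ i, ((σ i : ℤ) : ℝ) * y κ i ≠ 0 → col i = κ := fun i hi => by
            by_contra hne
            exact hi (by simp [hy, hne])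
          rw [h3 _ hi, h3 _ hi']
      rw [← eval_subTpoly, heq l, map_sub, map_add, map_sum, map_sum, hr, sub_zero, ← sum_diag_eq]
      simp only [map_mul, map_prod, map_pow, MvPolynomial.eval_C, MvPolynomial.eval_X, mul_pow,
        hσpow, one_mul, Finset.prod_mul_distrib, ← mul_assoc, hcσ]
    rw [hII, Finset.sum_congr rfl fun l _ => h2 l, Finset.sum_add_distrib, Finset.sum_comm] at h1
    simpa only [mul_pow, hσpow, one_mul, Finset.sum_mul] using h1
  have hsum := Finset.sum_le_sum fun κ (_ : κ ∈ Finset.univ) => hpiece κ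
  have hpow : ∀ i, ∑ κ, y κ i ^ (m + 1) = x i ^ (m + 1) := fun i => by
    simp [hy, ite_pow]
  have hmon : ∀ l g, ∑ κ, |c l g| * ∏ j, y κ (g j) = |c l g| * ∏ j, x (g j) := by
    intro l g
    rcases hcol l with ⟨-, hc⟩ | ⟨h0, -⟩
    · rw [← Finset.mul_sum, Finset.sum_eq_single (col (g 0))]
      · refine congrArg _ (Finset.prod_congr rfl fun j _ => ?_)
        simp [hy, hc (g j) (g j).2 (g 0) (g 0).2]
      · intro κ _ hκ
        exact Finset.prod_eq_zero (Finset.mem_univ 0) (by simp [hy, hκ.symm])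
      · simp
    · simp [h0]
  rw [Finset.sum_add_distrib, ← Finset.mul_sum, Finset.sum_comm,
    Finset.sum_comm (f := fun κ i => y κ i ^ (m + 1)),
    Finset.sum_comm (t := Finset.univ (α := Fin s))] at hsum
  simp only [← Finset.mul_sum, hpow] at hsum
  rw [Fintype.sum_sigma]
  refine le_of_eq_of_le (congrArg _ (Finset.sum_congr rfl fun l _ => ?_)) hsum
  rw [Finset.sum_comm]
  exact Finset.sum_congr rfl fun g _ => (hmon l g).symm

/-- A bound on the form of a W-tensor splits into sums-of-squares certificates on the blocks. -/
theorem exists_sos_decomposition {m n s : ℕ} (hn : 0 < n) (heven : Even (m + 1))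
    (A : (Fin (m + 1) → Fin n) → ℝ)
    (Γ : Fin s → Finset (Fin n)) (B : ∀ l : Fin s, (Fin (m + 1) → Γ l) → ℝ)
    (hI : WCondI Γ)
    (hII : ∀ x : Fin n → ℝ, tmul A x = ∑ l, subTmul (Γ l) (B l) x)
    (hIII : ∀ l, WCondIII (B l))
    (L : ℝ) (hL : ∀ x, tmul A x ≤ L * ∑ i, x i ^ (m + 1)) :
    ∃ ρ : Fin s → Fin n → ℝ,
      (∀ l, IsSOSPoly (- subTpoly (Γ l) (B l)
          + ∑ i : ↥(Γ l), (MvPolynomial.C (ρ l i.1) * MvPolynomial.X i ^ (m + 1)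
              : MvPolynomial ↥(Γ l) ℝ))) ∧
      (∀ i : Fin n, ∑ l ∈ Finset.univ.filter (fun l => i ∈ Γ l), ρ l i ≤ L) := by
  classical
  have : Nonempty (Fin n) := ⟨⟨0, hn⟩⟩
  choose c r heq hr hsign hvan using fun l => (hIII l).exists_normal_form heven
  obtain ⟨σ, hσ⟩ := exists_glued_assignment Γ hI
    (fun l (h : Fin n → ℤˣ) => ∀ g, 0 ≤ c l g * ∏ j, ((h (g j) : ℤ) : ℝ)) hn
    (fun l f f' hff hf g => by
      have h : ∀ j, f' (g j) = f (g j) := fun j => (hff _ (g j).2).symm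
      simpa only [h] using hf g) hsign
  obtain ⟨col, hcol⟩ := exists_glued_assignment Γ hI
    (fun l (h : Fin n → Fin n) => (r l = 0 ∧ ∀ i ∈ Γ l, ∀ i' ∈ Γ l, h i = h i') ∨
      (c l = 0 ∧ Set.InjOn h (Γ l) ∧ ∀ x : Γ l → ℝ, (∀ i i', x i ≠ 0 → x i' ≠ 0 → i = i') →
        MvPolynomial.eval x (r l) = 0)) hn
    (fun l f f' hff hf => by
      rcases hf with ⟨h0, h⟩ | ⟨h0, h, h'⟩
      · exact Or.inl ⟨h0, fun i hi i' hi' => by rw [← hff i hi, ← hff i' hi', h i hi i' hi']⟩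
      · exact Or.inr ⟨h0, h.congr fun i hi => hff i hi, h'⟩)
    (fun l v a => by
      rcases hvan l with h0 | ⟨h0, h⟩
      · exact ⟨fun _ => a, Or.inl ⟨h0, fun _ _ _ _ => rfl⟩, rfl⟩
      · exact ⟨Equiv.swap v a, Or.inr ⟨h0, (Equiv.injective _).injOn, h⟩,
          Equiv.swap_apply_left v a⟩)
  obtain ⟨w, hw0, hwp, hwL⟩ := exists_weights m.succ_pos
    (fun k : (Σ l, (Fin (m + 1) → Γ l)) => fun j => ((k.2 j : Fin n)))
    (fun k => |c k.1 k.2|) (fun k => abs_nonneg _) (fun i => ∑ l, diagCoeff (Γ l) (B l) i) L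
    (fun x _ => sum_abs_le_of_tmul_le heven A Γ B hII c r heq σ hσ col hcol L hL x)
  refine ⟨fun l i => diagCoeff (Γ l) (B l) i
    + ∑ g, ∑ j, (if ((g j : Γ l) : Fin n) = i then w ⟨l, g⟩ j else 0), fun l => ?_, fun i => ?_⟩
  · refine isSOSPoly_of_isSumSq ?_
    have h1 : IsSumSq (∑ g, (∑ j, MvPolynomial.C (w ⟨l, g⟩ j) * MvPolynomial.X (g j) ^ (m + 1)
        - MvPolynomial.C (c l g) * ∏ j, (MvPolynomial.X (g j) : MvPolynomial (Γ l) ℝ))) :=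
      IsSumSq.sum fun g _ => isSumSq_weighted_amgm heven m.succ_pos _ _ (hw0 ⟨l, g⟩) (c l g)
        (fun j => σ (g j)) (hσ l g) (hwp ⟨l, g⟩)
    refine (h1.add (hr l)).of_eq ?_
    have h2 : ∑ i : Γ l, (MvPolynomial.C (∑ g, ∑ j,
          (if ((g j : Γ l) : Fin n) = i then w ⟨l, g⟩ j else 0)) * MvPolynomial.X i ^ (m + 1)
          : MvPolynomial (Γ l) ℝ)
        = ∑ g, ∑ j, MvPolynomial.C (w ⟨l, g⟩ j) * MvPolynomial.X (g j) ^ (m + 1) := by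
      simp only [map_sum, Finset.sum_mul]
      rw [Finset.sum_comm]
      refine Finset.sum_congr rfl fun g _ => ?_
      rw [Finset.sum_comm]
      refine Finset.sum_congr rfl fun j _ => ?_
      rw [Finset.sum_eq_single (g j)]
      · simp
      · intro i _ hi
        rw [if_neg fun h => hi (Subtype.ext h).symm, map_zero, zero_mul]
      · simp
    have h3 : ∀ i : Γ l, diagCoeff (Γ l) (B l) i = B l fun _ => i := fun i => by simp [diagCoeff]
    rw [heq l]
    simp only [map_add, add_mul, Finset.sum_add_distrib, h2, h3, Finset.sum_sub_distrib]
    ring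
  · refine le_of_eq_of_le ?_ (hwL i)
    rw [Fintype.sum_sigma, ← Finset.sum_add_distrib]
    refine Finset.sum_subset (Finset.subset_univ _) fun l _ hl => ?_
    have hl' : i ∉ Γ l := by simpa using hl
    have h1 : ∀ (g : Fin (m + 1) → Γ l) j, ((g j : Γ l) : Fin n) ≠ i := fun g j h =>
      hl' (h ▸ (g j).2)
    simp [diagCoeff, hl', h1]

theorem IsSOSPoly.eval_nonneg {σ : Type*} {p : MvPolynomial σ ℝ} (hp : IsSOSPoly p)
    (x : σ → ℝ) : 0 ≤ MvPolynomial.eval x p := by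
  obtain ⟨r, q, rfl⟩ := hp
  rw [map_sum]
  exact Finset.sum_nonneg fun j _ => by rw [map_pow]; exact sq_nonneg _

/-- Sums-of-squares certificates on the blocks bound the whole form. -/
theorem tmul_le_of_sos {m n s : ℕ} (heven : Even (m + 1)) (A : (Fin (m + 1) → Fin n) → ℝ)
    (Γ : Fin s → Finset (Fin n)) (B : ∀ l : Fin s, (Fin (m + 1) → Γ l) → ℝ)
    (hII : ∀ x : Fin n → ℝ, tmul A x = ∑ l, subTmul (Γ l) (B l) x)
    (ρ : Fin s → Fin n → ℝ)
    (hρ : ∀ l, IsSOSPoly (- subTpoly (Γ l) (B l)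
      + ∑ i : ↥(Γ l), (MvPolynomial.C (ρ l i.1) * MvPolynomial.X i ^ (m + 1)
          : MvPolynomial ↥(Γ l) ℝ)))
    (t : ℝ) (ht : ∀ i : Fin n, ∑ l ∈ Finset.univ.filter (fun l => i ∈ Γ l), ρ l i ≤ t)
    (x : Fin n → ℝ) : tmul A x ≤ t * ∑ i, x i ^ (m + 1) := by
  have h1 : ∀ l, subTmul (Γ l) (B l) x ≤ ∑ i, if i ∈ Γ l then ρ l i * x i ^ (m + 1) else 0 := by
    intro l
    have h := (hρ l).eval_nonneg fun i => x i
    simp only [map_add, map_neg, eval_subTpoly, map_sum, map_mul, map_pow, MvPolynomial.eval_C,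
      MvPolynomial.eval_X] at h
    rw [Finset.sum_coe_sort (Γ l) fun i => ρ l i * x i ^ (m + 1)] at h
    rw [← Finset.sum_filter, Finset.filter_mem_eq_inter, Finset.univ_inter]
    linarith
  rw [hII]
  refine (Finset.sum_le_sum fun l _ => h1 l).trans ?_
  rw [Finset.sum_comm, Finset.mul_sum]
  refine Finset.sum_le_sum fun i _ => ?_
  rw [← Finset.sum_filter, ← Finset.sum_mul]
  exact mul_le_mul_of_nonneg_right (ht i) (heven.pow_nonneg _)

/-- Theorem 3.2, equation (3.3): for an even-order symmetric W-tensor with decomposition data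
`Γ_l`, `𝒜_{Γ_l}`, `λ_max(𝒜) = min { t | ∃ ρ_i^l, each −𝒜_{Γ_l}x_{Γ_l}^m + ∑_{i∈Γ_l} ρ_i^l x_i^m
is SOS and ∑_{l ∈ Λ(i)} ρ_i^l ≤ t for every i }`, and the minimum is attained. -/
theorem theorem32_second (m n s : ℕ) (hn : 0 < n) (heven : Even (m + 1))
    (hspos : 0 < s) (hsn : s ≤ n)
    (A : (Fin (m + 1) → Fin n) → ℝ) (hsym : IsSymT A)
    (Γ : Fin s → Finset (Fin n)) (B : ∀ l : Fin s, (Fin (m + 1) → Γ l) → ℝ)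
    (hinj : Function.Injective Γ)
    (hcover : Finset.univ.biUnion Γ = Finset.univ)
    (hI : WCondI Γ)
    (hII : ∀ x : Fin n → ℝ, tmul A x = ∑ l, subTmul (Γ l) (B l) x)
    (hIII : ∀ l, WCondIII (B l)) :
    ∃ lmax : ℝ, IsHEig A lmax ∧ (∀ lam : ℝ, IsHEig A lam → lam ≤ lmax) ∧
      IsLeast {t : ℝ | ∃ ρ : Fin s → Fin n → ℝ,
        (∀ l, IsSOSPoly (- subTpoly (Γ l) (B l)
            + ∑ i : ↥(Γ l), (MvPolynomial.C (ρ l i.1) * MvPolynomial.X i ^ (m + 1)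
                : MvPolynomial ↥(Γ l) ℝ))) ∧
        (∀ i : Fin n, ∑ l ∈ Finset.univ.filter (fun l => i ∈ Γ l), ρ l i ≤ t)} lmax := by
  obtain ⟨L, hL, hmax, hbound, x, hx, hxL⟩ := exists_isHEig_max hn heven A hsym
  refine ⟨L, hL, hmax, exists_sos_decomposition hn heven A Γ B hI hII hIII L hbound, ?_⟩
  rintro t ⟨ρ, hρ, ht⟩
  simpa [hx, hxL] using tmul_le_of_sos heven A Γ B hII ρ hρ t ht x

end
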